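/- arXiv:1504.04405 — 3 statements merged into one kernel-verified Lean document; each statement's English description precedes it below -/
import Mathlib

section
/- Let D ⊆ ℂ be an open set and let Z ⊆ D be a subset having no accumulation point in D (every point of Z is isolated and no point of D is a cluster point of Z). Then there exists a function f : ℂ → ℂ holomorphic on D such that for every z ∈ D, f(z) = 0 if and only if z ∈ Z. (Mittag-Leffler's 1884 extension of Weierstrass's theorem to arbitrary domains.) -/
open Filter Metric Set Topology

/-- The Weierstrass elementary factor of order `n`, written using `Complex.logTaylor`. -/
noncomputable def weierstrassFactor (n : ℕ) (w : ℂ) : ℂ :=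
  (1 - w) * Complex.exp (-Complex.logTaylor (n + 1) (-w))

lemma differentiable_weierstrassFactor (n : ℕ) : Differentiable ℂ (weierstrassFactor n) := by
  have h : Differentiable ℂ (Complex.logTaylor (n + 1)) :=
    fun z ↦ (Complex.hasDerivAt_logTaylor n z).differentiableAt
  have h' : Differentiable ℂ fun w : ℂ ↦ Complex.logTaylor (n + 1) (-w) := h.comp differentiable_neg
  unfold weierstrassFactor
  fun_prop

lemma weierstrassFactor_eq_zero_iff {n : ℕ} {w : ℂ} : weierstrassFactor n w = 0 ↔ w = 1 := by
  simp [weierstrassFactor, sub_eq_zero, eq_comm (a := w)]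

lemma norm_weierstrassFactor_sub_one_le (n : ℕ) {w : ℂ} (hw : ‖w‖ ≤ 1 / 2) :
    ‖weierstrassFactor n w - 1‖ ≤ 2 * (1 / 2) ^ n := by
  set u : ℂ := Complex.log (1 + -w) - Complex.logTaylor (n + 1) (-w) with hu
  have hw1 : 1 + -w ≠ 0 := by
    intro h
    have : w = 1 := by linear_combination -h
    norm_num [this] at hw
  have hexp : weierstrassFactor n w = Complex.exp u := by
    rw [hu, sub_eq_add_neg (Complex.log _), Complex.exp_add, Complex.exp_log hw1,
      weierstrassFactor, sub_eq_add_neg 1 w]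
  have hbound : ‖u‖ ≤ (1 / 2) ^ n := by
    have h := Complex.norm_log_sub_logTaylor_le n (z := -w) (by rw [norm_neg]; linarith)
    rw [norm_neg] at h
    calc ‖u‖ ≤ ‖w‖ ^ (n + 1) * (1 - ‖w‖)⁻¹ / (n + 1) := h
      _ ≤ ‖w‖ ^ (n + 1) * (1 - ‖w‖)⁻¹ := by
          refine div_le_self (mul_nonneg (by positivity) (inv_nonneg.2 (by linarith))) ?_
          linarith [Nat.cast_nonneg (α := ℝ) n]
      _ ≤ (1 / 2) ^ (n + 1) * 2 := by
          have hinv : (0 : ℝ) ≤ (1 - ‖w‖)⁻¹ := inv_nonneg.2 (by linarith)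
          gcongr
          rw [inv_le_comm₀ (by linarith) two_pos]
          linarith
      _ = (1 / 2) ^ n := by ring
  rw [hexp]
  have h1 : ‖u‖ ≤ 1 := hbound.trans (pow_le_one₀ (by norm_num) (by norm_num))
  linarith [Complex.norm_exp_sub_one_le h1]

/-- A family `w a`, for `a ∈ D`, of holomorphic functions on `D` such that `w a` takes the
value `1` exactly at `a`, and which is small on any compact set when `a` leaves the compact
subsets of `D`. -/
lemma exists_family_eq_one_iff_and_norm_le_half {D : Set ℂ} (hD : IsOpen D) :
    ∃ w : ℂ → ℂ → ℂ, (∀ a ∈ D, DifferentiableOn ℂ (w a) D) ∧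
      (∀ a ∈ D, ∀ z ∈ D, w a z = 1 ↔ z = a) ∧
      ∀ K ⊆ D, IsCompact K → ∃ L ⊆ D, IsCompact L ∧
        ∀ a ∈ D, a ∉ L → ∀ z ∈ K, ‖w a z‖ ≤ 1 / 2 := by
  by_cases hne : (Dᶜ).Nonempty
  swap
  · have hDu : D = univ := by simpa [not_nonempty_iff_eq_empty] using hne
    subst hDu
    refine ⟨fun a z ↦ if a = 0 then 1 - z else z / a, fun a _ ↦ ?_, fun a _ z _ ↦ ?_,
      fun K _ hK ↦ ?_⟩
    · by_cases ha : a = 0 <;> simp only [ha, if_true, if_false] <;> fun_prop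
    · by_cases ha : a = 0
      · simp [ha]
      · simp [ha, div_eq_one_iff_eq]
    · obtain ⟨R, hR, hKR⟩ := hK.isBounded.exists_pos_norm_le
      refine ⟨closedBall 0 (2 * R), subset_univ _, isCompact_closedBall _ _, fun a _ ha z hz ↦ ?_⟩
      rw [mem_closedBall_zero_iff, not_le] at ha
      have ha0 : a ≠ 0 := norm_pos_iff.1 (by linarith)
      simp only [if_neg ha0]
      rw [norm_div, div_le_iff₀ (by linarith)]
      linarith [hKR z hz]
  choose b hbD hb using hD.isClosed_compl.exists_infDist_eq_dist hne
  have hzb : ∀ a, ∀ z ∈ D, z - b a ≠ 0 := fun a z hz h ↦ hbD a (sub_eq_zero.1 h ▸ hz)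
  refine ⟨fun a z ↦ if ‖a‖ * infDist a Dᶜ ≤ 1 then (a - b a) / (z - b a) else z / a,
    fun a _ ↦ ?_, fun a _ z hz ↦ ?_, fun K hKD hK ↦ ?_⟩
  · beta_reduce
    split_ifs
    · exact (differentiableOn_const _).div (by fun_prop) (hzb a)
    · fun_prop
  · beta_reduce
    split_ifs with h
    · rw [div_eq_one_iff_eq (hzb a z hz), sub_left_inj, eq_comm]
    · have ha : a ≠ 0 := by rintro rfl; simp at h
      rw [div_eq_one_iff_eq ha]
  · obtain ⟨R, hR, hKR⟩ := hK.isBounded.exists_pos_norm_le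
    obtain ⟨δ, hδ, hKδ⟩ := hK.exists_thickening_subset_open hD hKD
    have hε : 0 < min (δ / 2) (1 / (2 * R)) := by positivity
    refine ⟨closedBall 0 (max (2 * R) (2 / δ)) ∩
      {a | min (δ / 2) (1 / (2 * R)) ≤ infDist a Dᶜ}, fun a ha ↦ ?_, ?_, fun a _ haL z hz ↦ ?_⟩
    · by_contra haD
      have h := ha.2
      rw [mem_ofPred_eq, infDist_zero_of_mem haD] at h
      exact h.not_gt hε
    · exact (isCompact_closedBall _ _).inter_right
        (isClosed_le continuous_const (continuous_infDist_pt _))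
    · simp only [mem_inter_iff, mem_closedBall_zero_iff, mem_ofPred_eq, le_max_iff, min_le_iff,
        not_and_or, not_or, not_le] at haL
      beta_reduce
      split_ifs with h
      · have hdz : δ ≤ ‖z - b a‖ := by
          by_contra! hlt
          refine hbD a (hKδ (mem_thickening_iff.2 ⟨z, hz, ?_⟩))
          rwa [dist_comm, dist_eq_norm]
        have hda : infDist a Dᶜ < δ / 2 := by
          by_contra! hle
          refine haL.elim (fun h' ↦ h'.2.not_ge ?_) fun h' ↦ h'.1.not_ge hle
          rw [le_div_iff₀ hδ]
          nlinarith [norm_nonneg a]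
        rw [norm_div, div_le_iff₀ (hδ.trans_le hdz), ← dist_eq_norm, ← hb a]
        linarith
      · rw [not_le] at h
        have haR : 2 * R < ‖a‖ := by
          by_contra! hle
          refine haL.elim (fun h' ↦ h'.1.not_ge hle) fun h' ↦ h'.2.not_ge ?_
          rw [div_le_iff₀ (by positivity)]
          nlinarith [infDist_nonneg (x := a) (s := Dᶜ)]
        rw [norm_div, div_le_iff₀ (by linarith)]
        linarith [hKR z hz]

/-- Mittag-Leffler's 1884 extension of Weierstrass's theorem: if `Z` is a
subset of an open set `D ⊆ ℂ` having no accumulation point in `D`, then there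
is a function holomorphic on `D` whose zero set in `D` is exactly `Z`. -/
theorem weierstrass_zeros_in_domain (D : Set ℂ) (hD : IsOpen D) (Z : Set ℂ)
    (hZD : Z ⊆ D) (hacc : ∀ z ∈ D, ¬ AccPt z (Filter.principal Z)) :
    ∃ f : ℂ → ℂ, DifferentiableOn ℂ f D ∧ ∀ z ∈ D, (f z = 0 ↔ z ∈ Z) := by
  have : DiscreteTopology Z := discreteTopology_of_noAccPts fun z hz ↦ hacc z (hZD hz)
  have : Countable Z := TopologicalSpace.separableSpace_iff_countable.1 inferInstance
  obtain ⟨e, he⟩ := exists_injective_nat Z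
  obtain ⟨w, hwd, hw1, hw⟩ := exists_family_eq_one_iff_and_norm_le_half hD
  set E : Z → ℂ → ℂ := fun a z ↦ weierstrassFactor (e a) (w a z) - 1 with hE
  have hEd : ∀ a, DifferentiableOn ℂ (E a) D := fun a ↦
    ((differentiable_weierstrassFactor (e a)).comp_differentiableOn (hwd a (hZD a.2))).sub_const 1
  have hE0 : ∀ a : Z, ∀ z ∈ D, 1 + E a z = 0 ↔ z = a := fun a z hz ↦ by
    rw [hE, add_sub_cancel, weierstrassFactor_eq_zero_iff, hw1 a (hZD a.2) z hz]
  have hsum : Summable fun a : Z ↦ 2 * (1 / 2 : ℝ) ^ e a :=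
    (summable_geometric_two.comp_injective he).mul_left 2
  have hbound : ∀ K ⊆ D, IsCompact K →
      ∀ᶠ a : Z in cofinite, ∀ z ∈ K, ‖E a z‖ ≤ 2 * (1 / 2 : ℝ) ^ e a := by
    intro K hKD hK
    obtain ⟨L, hLD, hL, hLw⟩ := hw K hKD hK
    have hfin : (Z ∩ L).Finite := by
      by_contra hinf
      obtain ⟨x, hx, hx'⟩ := Set.Infinite.exists_accPt_of_subset_isCompact hinf hL inter_subset_right
      exact hacc x (hLD hx) (hx'.mono (principal_mono.2 inter_subset_left))
    have hfin' : {a : Z | (a : ℂ) ∈ L}.Finite :=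
      Finite.of_finite_image (hfin.subset (by rintro _ ⟨a, ha, rfl⟩; exact ⟨a.2, ha⟩))
        Subtype.val_injective.injOn
    filter_upwards [hfin'.compl_mem_cofinite] with a ha z hz
    exact norm_weierstrassFactor_sub_one_le _ (hLw a (hZD a.2) ha z hz)
  have hprod : HasProdLocallyUniformlyOn (fun a z ↦ 1 + E a z) (fun z ↦ ∏' a, (1 + E a z)) D :=
    hasProdLocallyUniformlyOn_of_forall_compact hD fun K hKD hK ↦
      hsum.hasProdUniformlyOn_one_add hK (hbound K hKD hK)
        fun a ↦ (hEd a).continuousOn.mono hKD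
  refine ⟨fun z ↦ ∏' a, (1 + E a z), ?_, fun z hz ↦ ⟨fun h ↦ ?_, fun h ↦ ?_⟩⟩
  · refine TendstoLocallyUniformlyOn.differentiableOn hprod (Eventually.of_forall fun s ↦ ?_) hD
    exact DifferentiableOn.fun_finsetProd fun a _ ↦ (hEd a).const_add 1
  · by_contra hzZ
    refine tprod_one_add_ne_zero_of_summable (f := fun a ↦ E a z)
      (fun a h0 ↦ hzZ ((hE0 a z hz).1 h0 ▸ a.2)) ?_ h
    refine (hsum.of_norm_bounded_eventually (f := fun a ↦ E a z) ?_).norm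
    filter_upwards [hbound {z} (by simpa using hz) isCompact_singleton] with a ha using ha z rfl
  · exact tprod_of_exists_eq_zero ⟨⟨z, h⟩, (hE0 ⟨z, h⟩ z hz).2 rfl⟩
end

section
/- Let f : ℂ → ℂ be meromorphic on all of ℂ. Then there exist entire functions g, h : ℂ → ℂ with h not identically zero such that f(z) = g(z)/h(z) for all z outside some set that is closed and discrete in ℂ; equivalently, f(z) = g(z)/h(z) holds eventually along the codiscrete filter on ℂ. (Every meromorphic function on ℂ is a quotient of two entire functions.) -/
open Filter Metric Set Topology

/-- A nonvanishing holomorphic function on a disc has a holomorphic logarithm. -/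
theorem DifferentiableOn.exists_exp_eq_on_ball {f : ℂ → ℂ} {c : ℂ} {R : ℝ} (hR : 0 < R)
    (hf : DifferentiableOn ℂ f (ball c R)) (hf₀ : ∀ z ∈ ball c R, f z ≠ 0) :
    ∃ l : ℂ → ℂ, DifferentiableOn ℂ l (ball c R) ∧ ∀ z ∈ ball c R, Complex.exp (l z) = f z := by
  have hlog : DifferentiableOn ℂ (fun z ↦ _root_.deriv f z / f z) (ball c R) :=
    (hf.deriv isOpen_ball).div hf hf₀
  obtain ⟨l, hlc, hl⟩ := hlog.isExactOn_ball.with_val_at c (Complex.log (f c))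
  have hc : c ∈ ball c R := mem_ball_self hR
  have hder : ∀ z ∈ ball c R, HasDerivAt (fun z ↦ f z * Complex.exp (-l z)) 0 z := by
    intro z hz
    have h₁ := (hf.differentiableAt (isOpen_ball.mem_nhds hz)).hasDerivAt
    convert! h₁.mul (hl z hz).neg.cexp using 1
    have := hf₀ z hz
    field_simp
    ring
  refine ⟨l, fun z hz ↦ (hl z hz).differentiableAt.differentiableWithinAt, fun z hz ↦ ?_⟩
  have key : f z * Complex.exp (-l z) = f c * Complex.exp (-l c) :=
    isOpen_ball.is_const_of_deriv_eq_zero (convex_ball c R).isPreconnected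
      (fun w hw ↦ (hder w hw).differentiableAt.differentiableWithinAt)
      (fun w hw ↦ (hder w hw).deriv) hz hc
  rw [hlc, Complex.exp_neg, Complex.exp_neg, Complex.exp_log (hf₀ c hc),
    mul_inv_cancel₀ (hf₀ c hc)] at key
  have := Complex.exp_ne_zero (l z)
  field_simp at key
  exact key.symm

/-- A holomorphic function on a disc is uniformly approximated by entire functions on smaller
discs. -/
theorem DifferentiableOn.exists_differentiable_norm_sub_lt {f : ℂ → ℂ} {c : ℂ} {r R : ℝ}
    (hf : DifferentiableOn ℂ f (ball c R)) (hr : 0 ≤ r) (hrR : r < R) {ε : ℝ} (hε : 0 < ε) :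
    ∃ q : ℂ → ℂ, Differentiable ℂ q ∧ ∀ z ∈ ball c r, ‖f z - q z‖ < ε := by
  obtain ⟨s, hrs, hsR⟩ := exists_between hrR
  lift r to NNReal using hr
  lift s to NNReal using r.2.trans hrs.le
  have hs : 0 < s := lt_of_le_of_lt (zero_le (a := r)) (by exact_mod_cast hrs)
  have hp := (hf.mono (closedBall_subset_ball hsR)).hasFPowerSeriesOnBall hs
  have hu := hp.tendstoUniformlyOn' (r' := r) (by exact_mod_cast hrs)
  obtain ⟨n, hn⟩ := (Metric.tendstoUniformlyOn_iff.1 hu ε hε).exists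
  refine ⟨_, ?_, fun z hz ↦ by simpa only [dist_eq_norm] using hn z hz⟩
  simp only [FormalMultilinearSeries.partialSum, FormalMultilinearSeries.apply_eq_pow_smul_coeff]
  fun_prop

/-- An entire function without zeros on a disc can be brought close to `1` on the concentric disc
of half the radius by multiplying with an entire function without zeros. -/
theorem exists_norm_mul_exp_sub_one_le {f : ℂ → ℂ} {c : ℂ} {R : ℝ}
    (hf : DifferentiableOn ℂ f (ball c R)) (hf₀ : ∀ z ∈ ball c R, f z ≠ 0)
    {ε : ℝ} (hε : 0 < ε) :
    ∃ q : ℂ → ℂ, Differentiable ℂ q ∧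
      ∀ z ∈ ball c (R / 2), ‖f z * Complex.exp (q z) - 1‖ ≤ ε := by
  rcases le_or_gt R 0 with hR | hR
  · refine ⟨0, differentiable_const 0, fun z hz ↦ ?_⟩
    rw [ball_eq_empty.2 (by linarith)] at hz
    exact hz.elim
  obtain ⟨l, hl, hle⟩ := hf.exists_exp_eq_on_ball hR hf₀
  obtain ⟨q, hq, hlq⟩ := hl.exists_differentiable_norm_sub_lt (r := R / 2) (by positivity)
    (by linarith) (ε := min 1 (ε / 2)) (by positivity)
  refine ⟨fun z ↦ -q z, hq.neg, fun z hz ↦ ?_⟩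
  have h := hlq z hz
  rw [← hle z (ball_subset_ball (by linarith) hz), ← Complex.exp_add, ← sub_eq_add_neg]
  have := Complex.norm_exp_sub_one_le (h.le.trans (min_le_left _ _))
  linarith [h.le.trans (min_le_right _ _)]

/-- An infinite product of entire functions, normally convergent on discs, is entire. -/
theorem differentiable_tprod_of_norm_sub_one_le {F : ℕ → ℂ → ℂ} {u : ℕ → ℝ} (hu : Summable u)
    (hF : ∀ n, Differentiable ℂ (F n))
    (hFu : ∀ R : ℝ, ∀ᶠ n in atTop, ∀ z ∈ ball (0 : ℂ) R, ‖F n z - 1‖ ≤ u n) :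
    Differentiable ℂ fun z ↦ ∏' n, F n z := by
  intro z
  have hz : z ∈ ball (0 : ℂ) (‖z‖ + 1) := by simp
  have h := Summable.hasProdLocallyUniformlyOn_nat_one_add (f := fun n z ↦ F n z - 1)
    isOpen_ball hu (hFu (‖z‖ + 1))
    (fun n ↦ ((hF n).sub_const 1).continuous.continuousOn)
  simp only [add_sub_cancel] at h
  rw [hasProdLocallyUniformlyOn_iff_tendstoLocallyUniformlyOn] at h
  refine (h.differentiableOn (.of_forall fun s ↦ ?_) isOpen_ball).differentiableAt
    (isOpen_ball.mem_nhds hz)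
  exact (Differentiable.fun_finsetProd fun n _ ↦ hF n).differentiableOn

/-- Pointwise summability from eventual uniform bounds on discs. -/
theorem summable_norm_sub_one {F : ℕ → ℂ → ℂ} {u : ℕ → ℝ} (hu : Summable u)
    (hFu : ∀ R : ℝ, ∀ᶠ n in atTop, ∀ z ∈ ball (0 : ℂ) R, ‖F n z - 1‖ ≤ u n) (z : ℂ) :
    Summable fun n ↦ ‖F n z - 1‖ := by
  refine hu.of_norm_bounded_eventually_nat ?_
  filter_upwards [hFu (‖z‖ + 1)] with n hn
  simpa using hn z (by simp)

/-- A weak form of the **Weierstrass product theorem**: there is a nonzero entire function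
vanishing to at least prescribed orders along a locally finite set. -/
theorem exists_differentiable_eq_pow_mul (m : ℂ → ℕ)
    (hm : ∀ r : ℝ, (closedBall (0 : ℂ) r ∩ m.support).Finite) :
    ∃ h : ℂ → ℂ, Differentiable ℂ h ∧ h ≠ 0 ∧
      ∀ a, ∃ k : ℂ → ℂ, Differentiable ℂ k ∧ ∀ z, h z = (z - a) ^ m a * k z := by
  have hfin : ∀ n : ℕ, {a : ℂ | a ∈ m.support ∧ ⌊‖a‖⌋₊ = n}.Finite := fun n ↦
    (hm (n + 1)).subset fun a ⟨ha, han⟩ ↦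
      ⟨by simpa [← han] using (Nat.lt_floor_add_one ‖a‖).le, ha⟩
  set s : ℕ → Finset ℂ := fun n ↦ (hfin n).toFinset with hs
  have mem_s : ∀ n a, a ∈ s n ↔ m a ≠ 0 ∧ ⌊‖a‖⌋₊ = n := fun n a ↦ by simp [hs]
  set P : ℕ → ℂ → ℂ := fun n z ↦ ∏ a ∈ s n, (z - a) ^ m a with hP
  have hPd : ∀ n, Differentiable ℂ (P n) := fun n ↦
    Differentiable.fun_finsetProd fun a _ ↦ by fun_prop
  have hP₀ : ∀ n z, z ∉ s n → P n z ≠ 0 := fun n z hz ↦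
    Finset.prod_ne_zero_iff.2 fun a ha ↦ pow_ne_zero _ <| sub_ne_zero.2 <| by
      rintro rfl; exact hz ha
  have hq : ∀ n : ℕ, ∃ q : ℂ → ℂ, Differentiable ℂ q ∧
      ∀ z ∈ ball (0 : ℂ) (n / 2), ‖P n z * Complex.exp (q z) - 1‖ ≤ (1 / 2 : ℝ) ^ n := by
    refine fun n ↦ exists_norm_mul_exp_sub_one_le (hPd n).differentiableOn
      (fun z hz ↦ hP₀ n z fun hzs ↦ ?_) (by positivity)
    have h₁ : ‖z‖ < n := by simpa using hz
    have h₂ := Nat.floor_le (norm_nonneg z)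
    rw [((mem_s n z).1 hzs).2] at h₂
    exact h₂.not_gt h₁
  choose q hqd hq using hq
  set F : ℕ → ℂ → ℂ := fun n z ↦ P n z * Complex.exp (q n z) with hF
  have hFd : ∀ n, Differentiable ℂ (F n) := fun n ↦ (hPd n).mul (hqd n).cexp
  have hu : Summable fun n : ℕ ↦ (1 / 2 : ℝ) ^ n := summable_geometric_two
  have hFu : ∀ R : ℝ, ∀ᶠ n : ℕ in atTop, ∀ z ∈ ball (0 : ℂ) R,
      ‖F n z - 1‖ ≤ (1 / 2 : ℝ) ^ n := by
    intro R
    filter_upwards [eventually_ge_atTop ⌈2 * R⌉₊] with n hn z hz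
    have := Nat.ceil_le.1 hn
    exact hq n z (ball_subset_ball (by linarith) hz)
  refine ⟨fun z ↦ ∏' n, F n z, differentiable_tprod_of_norm_sub_one_le hu hFd hFu, ?_, ?_⟩
  · obtain ⟨w, hw, hwm⟩ : ∃ w ∈ closedBall (0 : ℂ) 1, w ∉ closedBall (0 : ℂ) 1 ∩ m.support :=
      (infinite_of_mem_nhds (0 : ℂ) (closedBall_mem_nhds 0 one_pos)).exists_notMem_finite (hm 1)
    have hw₀ : ∀ n, w ∉ s n := fun n hn ↦ hwm ⟨hw, ((mem_s n w).1 hn).1⟩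
    intro h
    refine tprod_one_add_ne_zero_of_summable (f := fun n ↦ F n w - 1) (fun n ↦ ?_)
      (summable_norm_sub_one hu hFu w) (by simpa using congrFun h w)
    simpa [hF] using hP₀ n w (hw₀ n)
  · intro a
    set N := ⌊‖a‖⌋₊ with hN
    obtain ⟨k, hk, hPk⟩ : ∃ k : ℂ → ℂ, Differentiable ℂ k ∧ ∀ z, P N z = (z - a) ^ m a * k z := by
      by_cases ha : m a = 0
      · exact ⟨P N, hPd N, by simp [ha]⟩
      · refine ⟨fun z ↦ ∏ b ∈ (s N).erase a, (z - b) ^ m b,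
          Differentiable.fun_finsetProd fun b _ ↦ by fun_prop, fun z ↦ ?_⟩
        exact (Finset.mul_prod_erase _ _ ((mem_s N a).2 ⟨ha, rfl⟩)).symm
    set G : ℕ → ℂ → ℂ := Function.update F N 1 with hG
    have hGd : ∀ n, Differentiable ℂ (G n) := by
      intro n
      rcases eq_or_ne n N with rfl | hn
      · simp [hG]
      · simpa [hG, hn] using hFd n
    have hGu : ∀ R : ℝ, ∀ᶠ n : ℕ in atTop, ∀ z ∈ ball (0 : ℂ) R,
        ‖G n z - 1‖ ≤ (1 / 2 : ℝ) ^ n := by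
      intro R
      filter_upwards [hFu R, eventually_ne_atTop N] with n hn hnN z hz
      simpa [hG, hnN] using hn z hz
    refine ⟨fun z ↦ k z * Complex.exp (q N z) * ∏' n, G n z,
      (hk.mul (hqd N).cexp).mul (differentiable_tprod_of_norm_sub_one_le hu hGd hGu),
      fun z ↦ ?_⟩
    have hGz : ∀ n, G n z = Function.update (fun n ↦ F n z) N 1 n := fun n ↦ by
      rcases eq_or_ne n N with rfl | hn
      · simp [hG]
      · simp [hG, hn]
    have hmul : Multipliable fun n ↦ G n z := by
      simpa using multipliable_one_add_of_summable (summable_norm_sub_one hu hGu z)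
    have := Multipliable.tprod_eq_mul_tprod_ite' (f := fun n ↦ F n z) N
      (hmul.congr hGz)
    simp only [this, hGz, Function.update_apply]
    simp only [hF, hPk]
    ring

/-- Every function meromorphic on all of `ℂ` is the quotient of two entire
functions: there are entire `g, h` with `h` not identically zero such that
`f = g/h` away from a set with no accumulation point in `ℂ` (i.e. a closed
discrete set). -/
theorem meromorphic_eq_quotient_of_entire (f : ℂ → ℂ)
    (hf : ∀ z : ℂ, MeromorphicAt f z) :
    ∃ g h : ℂ → ℂ, Differentiable ℂ g ∧ Differentiable ℂ h ∧ h ≠ 0 ∧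
      ∃ S : Set ℂ, (∀ z : ℂ, ¬ AccPt z (Filter.principal S)) ∧
        ∀ z ∉ S, f z = g z / h z := by
  have hfm : MeromorphicOn f univ := fun z _ ↦ hf z
  obtain ⟨h, hh, hh₀, hpow⟩ := exists_differentiable_eq_pow_mul
    (fun a ↦ (-MeromorphicOn.divisor f univ a).toNat) fun r ↦ by
      refine (Function.locallyFinsupp.locallyFiniteSupport
        (MeromorphicOn.divisor f univ)).finite_inter_support_of_isCompact
        (isCompact_closedBall (0 : ℂ) r) |>.subset ?_
      refine inter_subset_inter_right _ fun a ha ha' ↦ ha ?_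
      have : MeromorphicOn.divisor f univ a = 0 := ha'
      simp [this]
  have hhf : MeromorphicOn (h * f) univ := fun z _ ↦ (hh.analyticAt z).meromorphicAt.mul (hf z)
  have hord : ∀ a, 0 ≤ meromorphicOrderAt (h * f) a := by
    intro a
    obtain ⟨k, hk, hka⟩ := hpow a
    have hk' := (hk.analyticAt a).meromorphicOrderAt_nonneg
    have hX : MeromorphicAt (fun z : ℂ ↦ (z - a) ^ (-MeromorphicOn.divisor f univ a).toNat) a := by
      fun_prop
    have hhk : h = (fun z ↦ (z - a) ^ (-MeromorphicOn.divisor f univ a).toNat) * k := funext hka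
    rw [hhk, mul_comm _ k, mul_assoc, meromorphicOrderAt_mul (hk.analyticAt a).meromorphicAt
      (hX.mul (hf a)), meromorphicOrderAt_mul hX (hf a)]
    refine add_nonneg hk' ?_
    rw [MeromorphicOn.divisor_apply hfm (mem_univ a), fun_meromorphicOrderAt_pow_id_sub_const]
    cases meromorphicOrderAt f a with
    | top => simp
    | coe n =>
      norm_cast
      simp
      omega
  have hg : Differentiable ℂ (toMeromorphicNFOn (h * f) univ) := fun a ↦
    ((meromorphicNFOn_toMeromorphicNFOn (h * f) univ
      (mem_univ a)).meromorphicOrderAt_nonneg_iff_analyticAt.1 <| by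
        rw [meromorphicOrderAt_toMeromorphicNFOn hhf (mem_univ a)]
        exact hord a).differentiableAt
  obtain ⟨w, hw⟩ := Function.ne_iff.1 hh₀
  have hne := AnalyticOnNhd.preimage_zero_mem_codiscrete (fun z _ ↦ hh.analyticAt z) hw
  have heq := toMeromorphicNFOn_eqOn_codiscrete hhf
  refine ⟨_, h, hg, hh, hh₀, _, mem_codiscrete_accPt.1 (inter_mem hne heq), fun z hz ↦ ?_⟩
  obtain ⟨hz₀, hz⟩ := not_not.1 hz
  have hz' : (h * f) z = toMeromorphicNFOn (h * f) univ z := hz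
  rw [← hz', Pi.mul_apply, mul_div_cancel_left₀ _ hz₀]
end

section
/- Let ω₁, ω₂ ∈ ℂ with Im(ω₁/ω₂) ≠ 0, and let z ∈ ℂ be a point not of the form m·ω₁ + n·ω₂ for integers m, n. Then the family indexed by pairs (m, n) ∈ ℤ × ℤ with (m, n) ≠ (0, 0), with terms 1/(z − m·ω₁ − n·ω₂)² − 1/(m·ω₁ + n·ω₂)², is summable. -/
/-- Two complex numbers whose quotient is not real are linearly independent over `ℝ`. -/
theorem Complex.linearIndependent_pair_of_im_div_ne_zero {ω₁ ω₂ : ℂ} (h : (ω₁ / ω₂).im ≠ 0) :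
    LinearIndependent ℝ ![ω₁, ω₂] := by
  have hω₂ : ω₂ ≠ 0 := by
    rintro rfl
    simp at h
  rw [LinearIndependent.pair_iff]
  intro s t hst
  have hdiv : (s : ℂ) * (ω₁ / ω₂) + t = 0 := by
    simp only [Complex.real_smul] at hst
    field_simp
    linear_combination hst
  have hs : s = 0 := by simpa [h] using congrArg Complex.im hdiv
  subst hs
  exact ⟨rfl, by simpa using hdiv⟩

/-- Convergence of the series defining the Weierstrass `℘`-function: for
periods `ω₁, ω₂` with `Im (ω₁/ω₂) ≠ 0` and `z` not in the lattice, the family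
`1/(z − mω₁ − nω₂)² − 1/(mω₁ + nω₂)²`, indexed by `(m,n) ≠ (0,0)`, is
summable. -/
theorem weierstrass_p_summable (ω₁ ω₂ : ℂ) (hω : (ω₁ / ω₂).im ≠ 0) (z : ℂ)
    (hz : ∀ m n : ℤ, z ≠ m * ω₁ + n * ω₂) :
    Summable (fun p : {p : ℤ × ℤ // p ≠ (0, 0)} =>
      1 / (z - (p.1.1 : ℂ) * ω₁ - (p.1.2 : ℂ) * ω₂) ^ 2 -
        1 / ((p.1.1 : ℂ) * ω₁ + (p.1.2 : ℂ) * ω₂) ^ 2) := by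
  let L : PeriodPair := ⟨ω₁, ω₂, Complex.linearIndependent_pair_of_im_div_ne_zero hω⟩
  have hL := (L.hasSum_weierstrassP z).summable.comp_injective
    (L.latticeEquivProd.symm.injective.comp
      (Subtype.val_injective (p := fun p : ℤ × ℤ => p ≠ (0, 0))))
  refine hL.congr fun p => ?_
  simp [L.latticeEquiv_symm_apply, L, sub_sub]
end
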